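/- arXiv:math/0501303 — 3 statements merged into one kernel-verified Lean document; each statement's English description precedes it below -/
import Mathlib

section
/- For every n ≥ 2 and all P, Q ∈ Γ_n, one has h(P‖Q) − (1/4)·Δ(P‖Q) ≤ 3·[h(P‖Q) − I(P‖Q)]. -/
open Real BigOperators

noncomputable def triangularD {n : ℕ} (p q : Fin n → ℝ) : ℝ :=
  ∑ i, (p i - q i) ^ 2 / (p i + q i)

noncomputable def hellingerD {n : ℕ} (p q : Fin n → ℝ) : ℝ :=
  (1 / 2) * ∑ i, (Real.sqrt (p i) - Real.sqrt (q i)) ^ 2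

noncomputable def symChiSqD {n : ℕ} (p q : Fin n → ℝ) : ℝ :=
  ∑ i, (p i - q i) ^ 2 * (p i + q i) / (p i * q i)

noncomputable def jDiv {n : ℕ} (p q : Fin n → ℝ) : ℝ :=
  ∑ i, (p i - q i) * Real.log (p i / q i)

noncomputable def jsDiv {n : ℕ} (p q : Fin n → ℝ) : ℝ :=
  (1 / 2) * ((∑ i, p i * Real.log (2 * p i / (p i + q i))) +
    (∑ i, q i * Real.log (2 * q i / (p i + q i))))

noncomputable def agDiv {n : ℕ} (p q : Fin n → ℝ) : ℝ :=
  ∑ i, ((p i + q i) / 2) * Real.log ((p i + q i) / (2 * Real.sqrt (p i * q i)))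

noncomputable def dStar {n : ℕ} (p q : Fin n → ℝ) : ℝ :=
  ∑ i, (p i - q i) ^ 4 / Real.sqrt ((p i * q i) ^ 3)

lemma aux_g (t : ℝ) (h0 : 0 ≤ t) (h1 : t < 1) :
    0 ≤ 2 * (t / √(1 - t ^ 2)) + t - 3 / 2 * (Real.log (1 + t) - Real.log (1 - t)) := by
  have hd : ∀ x ∈ Set.Ico (0:ℝ) 1, HasDerivAt
      (fun t : ℝ => 2 * (t / √(1 - t ^ 2)) + t - 3 / 2 * (Real.log (1 + t) - Real.log (1 - t)))
      (2 * ((1 * √(1 - x ^ 2) - x * ((-(2 * x)) / (2 * √(1 - x ^ 2)))) / (√(1 - x ^ 2)) ^ 2) + 1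
        - 3 / 2 * (1 / (1 + x) - (-1) / (1 - x))) x := by
    intro x hx
    obtain ⟨hx0, hx1⟩ := hx
    have hpos : 0 < 1 - x ^ 2 := by nlinarith
    have hsq : HasDerivAt (fun t : ℝ => 1 - t ^ 2) (-(2 * x)) x := by
      simpa using (hasDerivAt_pow 2 x).const_sub 1
    have hs := hsq.sqrt hpos.ne'
    have hl1 : HasDerivAt (fun t : ℝ => Real.log (1 + t)) (1 / (1 + x)) x :=
      ((hasDerivAt_id x).const_add 1).log (by simp; linarith)
    have hl2 : HasDerivAt (fun t : ℝ => Real.log (1 - t)) ((-1) / (1 - x)) x :=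
      ((hasDerivAt_id x).const_sub 1).log (by simp; linarith)
    exact ((((hasDerivAt_id x).div hs (Real.sqrt_pos.2 hpos).ne').const_mul 2).add
      (hasDerivAt_id x)).sub ((hl1.sub hl2).const_mul (3 / 2))
  have hm := monotoneOn_of_deriv_nonneg (convex_Ico (0:ℝ) 1)
    (fun x hx => (hd x hx).continuousAt.continuousWithinAt)
    (fun x hx => (hd x (interior_subset hx)).differentiableAt.differentiableWithinAt)
    (fun x hx => by
      have hx' := interior_subset hx
      rw [(hd x hx').deriv]
      obtain ⟨hx0, hx1⟩ := hx'
      have hpos : 0 < 1 - x ^ 2 := by nlinarith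
      have hsp := Real.sqrt_pos.2 hpos
      have hss := Real.sq_sqrt hpos.le
      set s := √(1 - x ^ 2) with hsdef
      have e1 : (1 * s - x * ((-(2 * x)) / (2 * s))) / s ^ 2 = 1 / s ^ 3 := by
        field_simp
        linarith
      have e2 : 1 / (1 + x) - (-1) / (1 - x) = 2 / s ^ 2 := by
        rw [hss]
        have : 1 + x ≠ 0 := by linarith
        have : 1 - x ≠ 0 := by linarith
        have := hpos.ne'
        field_simp
        ring
      rw [e1, e2]
      have e3 : 2 * (1 / s ^ 3) + 1 - 3 / 2 * (2 / s ^ 2) = (1 - s) ^ 2 * (s + 2) / s ^ 3 := by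
        field_simp
        ring
      rw [e3]
      positivity)
  have := hm (show (0:ℝ) ∈ Set.Ico (0:ℝ) 1 by simp) ⟨h0, h1⟩ h0
  simpa using this

lemma aux_f (t : ℝ) (h0 : 0 ≤ t) (h1 : t < 1) :
    3 / 2 * ((1 + t) * Real.log (1 + t) + (1 - t) * Real.log (1 - t)) ≤
      2 * (1 - √(1 - t ^ 2)) + t ^ 2 / 2 := by
  have hd : ∀ x ∈ Set.Ico (0:ℝ) 1, HasDerivAt
      (fun t : ℝ => 2 * (1 - √(1 - t ^ 2)) + t ^ 2 / 2
        - 3 / 2 * ((1 + t) * Real.log (1 + t) + (1 - t) * Real.log (1 - t)))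
      (2 * (x / √(1 - x ^ 2)) + x - 3 / 2 * (Real.log (1 + x) - Real.log (1 - x))) x := by
    intro x hx
    obtain ⟨hx0, hx1⟩ := hx
    have hpos : 0 < 1 - x ^ 2 := by nlinarith
    have hsq : HasDerivAt (fun t : ℝ => 1 - t ^ 2) (-(2 * x)) x := by
      simpa using (hasDerivAt_pow 2 x).const_sub 1
    have hs := hsq.sqrt hpos.ne'
    have ha : HasDerivAt (fun t : ℝ => 1 + t) 1 x := (hasDerivAt_id x).const_add 1
    have hb : HasDerivAt (fun t : ℝ => 1 - t) (-1) x := (hasDerivAt_id x).const_sub 1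
    have hl1 := ha.mul (ha.log (by linarith))
    have hl2 := hb.mul (hb.log (by linarith))
    have h := (((hs.const_sub 1).const_mul 2).add ((hasDerivAt_pow 2 x).div_const 2)).sub
      ((hl1.add hl2).const_mul (3 / 2))
    refine h.congr_deriv ?_
    have : 1 + x ≠ 0 := by linarith
    have : 1 - x ≠ 0 := by linarith
    have := (Real.sqrt_pos.2 hpos).ne'
    simp only [Nat.cast_ofNat]
    field_simp
    ring
  have hm := monotoneOn_of_deriv_nonneg (convex_Ico (0:ℝ) 1)
    (fun x hx => (hd x hx).continuousAt.continuousWithinAt)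
    (fun x hx => (hd x (interior_subset hx)).differentiableAt.differentiableWithinAt)
    (fun x hx => by
      have hx' := interior_subset hx
      rw [(hd x hx').deriv]
      exact aux_g x hx'.1 hx'.2)
  have := hm (show (0:ℝ) ∈ Set.Ico (0:ℝ) 1 by simp) ⟨h0, h1⟩ h0
  simp at this
  linarith

lemma aux_f' (t : ℝ) (h0 : -1 < t) (h1 : t < 1) :
    3 / 2 * ((1 + t) * Real.log (1 + t) + (1 - t) * Real.log (1 - t)) ≤
      2 * (1 - √(1 - t ^ 2)) + t ^ 2 / 2 := by
  rcases le_total 0 t with h | h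
  · exact aux_f t h h1
  · have := aux_f (-t) (by linarith) (by linarith)
    simp only [neg_sq, sub_neg_eq_add, ← sub_eq_add_neg] at this
    linarith

lemma aux_pt (a b : ℝ) (ha : 0 < a) (hb : 0 < b) :
    3 / 2 * (a * Real.log (2 * a / (a + b)) + b * Real.log (2 * b / (a + b))) ≤
      (√a - √b) ^ 2 + 1 / 4 * ((a - b) ^ 2 / (a + b)) := by
  have hab : 0 < a + b := by linarith
  have h := aux_f' ((a - b) / (a + b)) (by rw [lt_div_iff₀ hab]; linarith)
    (by rw [div_lt_one hab]; linarith)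
  have e1 : 1 + (a - b) / (a + b) = 2 * a / (a + b) := by field_simp; ring
  have e2 : 1 - (a - b) / (a + b) = 2 * b / (a + b) := by field_simp; ring
  have e3 : √(1 - ((a - b) / (a + b)) ^ 2) = 2 * (√a * √b) / (a + b) := by
    rw [Real.sqrt_eq_iff_mul_self_eq_of_pos (by positivity)]
    have := Real.sq_sqrt ha.le
    have := Real.sq_sqrt hb.le
    have : (√a * √b) ^ 2 = a * b := by rw [mul_pow]; simp [*]
    field_simp
    linear_combination 4 * this
  rw [e1, e2, e3] at h
  have h2 := mul_le_mul_of_nonneg_left h (show 0 ≤ (a + b) / 2 by linarith)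
  have hsa := Real.sq_sqrt ha.le
  have hsb := Real.sq_sqrt hb.le
  have l : (a + b) / 2 * (3 / 2 * (2 * a / (a + b) * Real.log (2 * a / (a + b)) + 2 * b / (a + b) * Real.log (2 * b / (a + b)))) = 3 / 2 * (a * Real.log (2 * a / (a + b)) + b * Real.log (2 * b / (a + b))) := by
    generalize Real.log (2 * a / (a + b)) = A
    generalize Real.log (2 * b / (a + b)) = B
    field_simp
  have r : (a + b) / 2 * (2 * (1 - 2 * (√a * √b) / (a + b)) + ((a - b) / (a + b)) ^ 2 / 2) = (√a - √b) ^ 2 + 1 / 4 * ((a - b) ^ 2 / (a + b)) := by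
    have : (√a - √b) ^ 2 = a + b - 2 * (√a * √b) := by linear_combination hsa + hsb
    rw [this]
    field_simp
    ring
  rw [l, r] at h2
  exact h2

theorem stmt_7 (n : ℕ) (hn : 2 ≤ n) (p q : Fin n → ℝ)
    (hp : ∀ i, 0 < p i) (hq : ∀ i, 0 < q i)
    (hps : ∑ i, p i = 1) (hqs : ∑ i, q i = 1) :
    hellingerD p q - (1 / 4) * triangularD p q ≤ 3 * (hellingerD p q - jsDiv p q) := by
  have h := Finset.sum_le_sum (fun i (_ : i ∈ Finset.univ) => aux_pt (p i) (q i) (hp i) (hq i))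
  rw [← Finset.mul_sum, Finset.sum_add_distrib, Finset.sum_add_distrib, ← Finset.mul_sum] at h
  unfold hellingerD triangularD jsDiv
  linarith
end

section
/- For every n ≥ 2 and all P, Q ∈ Γ_n, one has h(P‖Q) − (1/4)·Δ(P‖Q) ≤ (3/4)·[(1/8)·J(P‖Q) − (1/4)·Δ(P‖Q)]. -/
open Real BigOperators

noncomputable def auxF (x : ℝ) : ℝ :=
  Real.log x - (8 / 3) * ((x - 1) / (x + 1)) + (1 / 3) * ((x ^ 2 - 1) / (x ^ 2 + 1))

theorem auxF_deriv (x : ℝ) (hx : 0 < x) : HasDerivAt auxF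
    ((x - 1) ^ 4 * (3 * x ^ 2 + 2 * x + 3) / (3 * x * (x + 1) ^ 2 * (x ^ 2 + 1) ^ 2)) x := by
  have h1 := Real.hasDerivAt_log hx.ne'
  have hi := hasDerivAt_id x
  have hs := hasDerivAt_pow 2 x
  have hx1 : x + 1 ≠ 0 := by positivity
  have hx2 : x ^ 2 + 1 ≠ 0 := by positivity
  have h2 := ((hi.sub_const 1).div (hi.add_const 1) hx1).const_mul (8 / 3)
  have h3 := ((hs.sub_const 1).div (hs.add_const 1) hx2).const_mul (1 / 3)
  refine HasDerivAt.congr_deriv (f := auxF) ((h1.sub h2).add h3) ?_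
  simp only [id]
  field_simp
  push_cast
  ring

theorem auxF_mono : MonotoneOn auxF (Set.Ioi 0) := by
  apply monotoneOn_of_deriv_nonneg (convex_Ioi 0)
  · intro x hx
    exact (auxF_deriv x hx).continuousAt.continuousWithinAt
  · intro x hx
    rw [interior_Ioi] at hx
    exact (auxF_deriv x hx).differentiableAt.differentiableWithinAt
  · intro x hx
    rw [interior_Ioi] at hx
    have hx0 : 0 < x := hx
    rw [(auxF_deriv x hx).deriv]
    positivity

theorem auxF_sign (x : ℝ) (hx : 0 < x) : 0 ≤ (x ^ 2 - 1) * auxF x := by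
  have h1 : auxF 1 = 0 := by simp [auxF]
  rcases le_total 1 x with h | h
  · have := auxF_mono (Set.mem_Ioi.2 one_pos) (Set.mem_Ioi.2 hx) h
    exact mul_nonneg (by nlinarith) (by linarith)
  · have := auxF_mono (Set.mem_Ioi.2 hx) (Set.mem_Ioi.2 one_pos) h
    exact mul_nonneg_of_nonpos_of_nonpos (by nlinarith) (by linarith)

theorem aux_pt_s9 (p q : ℝ) (hp : 0 < p) (hq : 0 < q) :
    (1 / 2) * (Real.sqrt p - Real.sqrt q) ^ 2 - (1 / 16) * ((p - q) ^ 2 / (p + q))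
      ≤ (3 / 32) * ((p - q) * Real.log (p / q)) := by
  obtain ⟨a, ha, rfl⟩ : ∃ a : ℝ, 0 < a ∧ a ^ 2 = p :=
    ⟨Real.sqrt p, Real.sqrt_pos.2 hp, Real.sq_sqrt hp.le⟩
  obtain ⟨b, hb, rfl⟩ : ∃ a : ℝ, 0 < a ∧ a ^ 2 = q :=
    ⟨Real.sqrt q, Real.sqrt_pos.2 hq, Real.sq_sqrt hq.le⟩
  rw [Real.sqrt_sq ha.le, Real.sqrt_sq hb.le, ← div_pow, Real.log_pow]
  have h := mul_nonneg (by positivity : 0 ≤ (3 / 16) * b ^ 2) (auxF_sign (a / b) (by positivity))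
  unfold auxF at h
  generalize Real.log (a / b) = L at *
  have e : (3 / 16) * b ^ 2 * (((a / b) ^ 2 - 1) * (L - (8 / 3) * ((a / b - 1) / (a / b + 1))
      + (1 / 3) * (((a / b) ^ 2 - 1) / ((a / b) ^ 2 + 1))))
      = (3 / 32) * ((a ^ 2 - b ^ 2) * ((2 : ℕ) * L)) - ((1 / 2) * (a - b) ^ 2
        - (1 / 16) * ((a ^ 2 - b ^ 2) ^ 2 / (a ^ 2 + b ^ 2))) := by
    push_cast
    field_simp
    ring
  linarith

theorem stmt_9 (n : ℕ) (hn : 2 ≤ n) (p q : Fin n → ℝ)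
    (hp : ∀ i, 0 < p i) (hq : ∀ i, 0 < q i)
    (hps : ∑ i, p i = 1) (hqs : ∑ i, q i = 1) :
    hellingerD p q - (1 / 4) * triangularD p q ≤ (3 / 4) * ((1 / 8) * jDiv p q - (1 / 4) * triangularD p q) := by
  have h := Finset.sum_le_sum (fun i (_ : i ∈ Finset.univ) => aux_pt_s9 (p i) (q i) (hp i) (hq i))
  rw [Finset.sum_sub_distrib, ← Finset.mul_sum, ← Finset.mul_sum, ← Finset.mul_sum] at h
  unfold hellingerD triangularD jDiv
  linarith
end

section
/- For every n ≥ 2 and all P, Q ∈ Γ_n, one has T(P‖Q) − (1/4)·Δ(P‖Q) ≤ 3·[T(P‖Q) − (1/8)·J(P‖Q)]. -/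
open Real BigOperators

theorem aux_series (u : ℝ) (hu : |u| < 1) :
    0 ≤ -Real.log (1 - u ^ 2) + u ^ 2 / 2
      - 3 / 4 * (u * (Real.log (1 + u) - Real.log (1 - u))) := by
  have h2 : |u ^ 2| < 1 := by
    rw [abs_pow]
    exact pow_lt_one₀ (abs_nonneg u) hu (by norm_num)
  have hA := Real.hasSum_pow_div_log_of_abs_lt_one h2
  have hB := ((Real.hasSum_log_sub_log_of_abs_lt_one hu).mul_left u).mul_left (3 / 4)
  have hC := hA.sub hB
  have key := sum_le_hasSum {0} (fun k hk => ?_) hC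
  · simp at key
    nlinarith [key]
  · have hk1 : (1 : ℝ) ≤ k := by
      have : k ≠ 0 := by simpa using hk
      exact_mod_cast Nat.one_le_iff_ne_zero.mpr this
    have e : (u ^ 2) ^ (k + 1) / ((k : ℝ) + 1)
        - 3 / 4 * (u * (2 * (1 / (2 * (k : ℝ) + 1)) * u ^ (2 * k + 1)))
        = (u ^ 2) ^ (k + 1) * (((k : ℝ) - 1) / (2 * (k + 1) * (2 * k + 1))) := by
      have : u * u ^ (2 * k + 1) = (u ^ 2) ^ (k + 1) := by ring
      rw [← this]
      field_simp
      ring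
    rw [e]
    have : (0 : ℝ) ≤ k - 1 := by linarith
    positivity

theorem aux_term (a b : ℝ) (ha : 0 < a) (hb : 0 < b) :
    0 ≤ 2 * (((a + b) / 2) * Real.log ((a + b) / (2 * Real.sqrt (a * b))))
      + 1 / 4 * ((a - b) ^ 2 / (a + b)) - 3 / 8 * ((a - b) * Real.log (a / b)) := by
  have hab : 0 < a + b := by linarith
  have hu : |(a - b) / (a + b)| < 1 := by
    rw [abs_lt, lt_div_iff₀ hab, div_lt_iff₀ hab]
    constructor <;> linarith
  have h := aux_series _ hu
  have e1 : 1 - ((a - b) / (a + b)) ^ 2 = (2 * 2 * (a * b)) / (a + b) ^ 2 := by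
    field_simp
    ring
  have e2 : 1 + (a - b) / (a + b) = 2 * a / (a + b) := by
    field_simp
    ring
  have e3 : 1 - (a - b) / (a + b) = 2 * b / (a + b) := by
    field_simp
    ring
  rw [e1, e2, e3, Real.log_div (by positivity) (by positivity),
    Real.log_div (by positivity) (by positivity), Real.log_div (by positivity) (by positivity),
    Real.log_mul (by positivity) (by positivity), Real.log_mul (by positivity) (by positivity),
    Real.log_mul (by positivity) (by positivity), Real.log_mul (by positivity) (by positivity),
    Real.log_mul (by positivity) (by positivity), Real.log_pow] at h
  rw [Real.log_div (by positivity) (by positivity), Real.log_div (by positivity) (by positivity),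
    Real.log_mul (by positivity) (by positivity), Real.log_sqrt (by positivity),
    Real.log_mul (by positivity) (by positivity)]
  have h' := mul_nonneg (half_pos hab).le h
  refine le_of_le_of_eq h' ?_
  push_cast
  field_simp
  ring

theorem stmt_11 (n : ℕ) (hn : 2 ≤ n) (p q : Fin n → ℝ)
    (hp : ∀ i, 0 < p i) (hq : ∀ i, 0 < q i)
    (hps : ∑ i, p i = 1) (hqs : ∑ i, q i = 1) :
    agDiv p q - (1 / 4) * triangularD p q ≤ 3 * (agDiv p q - (1 / 8) * jDiv p q) := by
  have h := Finset.sum_nonneg (s := Finset.univ)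
    (fun i _ => aux_term (p i) (q i) (hp i) (hq i))
  rw [Finset.sum_sub_distrib, Finset.sum_add_distrib, ← Finset.mul_sum, ← Finset.mul_sum,
    ← Finset.mul_sum] at h
  unfold agDiv triangularD jDiv
  linarith
end
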